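/- arXiv:2006.08557 — 2 statements merged into one kernel-verified Lean document; each statement's English description precedes it below -/
import Mathlib

section
/- Let k be a field and V a virtually tame correspondence module over (ℝ, ≤). Let I₁ ⊆ I₂ ⊆ I₃ ⊆ ⋯ be an ascending sequence of intervals of ℝ and A ⊆ ⋂_n I_n a finite set. Then there exists m₀ such that for all m ≥ m₀ and every section s of V over I_m there is a section g of V over ⋃_n I_n with g(t) = s(t) for all t ∈ A. (That is, the restrictions to A of sections over I_m coincide with the restrictions to A of sections over ⋃_n I_n, for m large.) -/
/-- Composition of correspondences (as sets of pairs): first `C`, then `D`. -/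
def CorrComp {U V W : Type*} (C : Set (U × V)) (D : Set (V × W)) : Set (U × W) :=
  {p : U × W | ∃ v : V, (p.1, v) ∈ C ∧ (v, p.2) ∈ D}

/-- A chain of sets is stable (eventually constant). -/
def EvConst {α : Type*} (c : ℕ → Set α) : Prop := ∃ N : ℕ, ∀ n ≥ N, c n = c N

section

variable {k : Type*} [Field k] (V : ℝ → Type*)
  [∀ t, AddCommGroup (V t)] [∀ t, Module k (V t)]
  (v : ∀ s t : ℝ, s ≤ t → Submodule k (V s × V t))

/-- `f` is a section of the correspondence module `(V, v)` over `A ⊆ ℝ`. -/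
def IsSection (A : Set ℝ) (f : ∀ t : ℝ, V t) : Prop :=
  ∀ r ∈ A, ∀ t ∈ A, ∀ hrt : r ≤ t, (f r, f t) ∈ v r t hrt

/-- The descending chain condition on images (at every `t ∈ ℝ`). -/
def DCConImages : Prop :=
  ∀ t : ℝ,
    (∀ (l : ℕ → ℝ) (hl : ∀ n, l n ≤ t), Antitone l →
      EvConst (fun n => {y : V t | ∃ x : V (l n), (x, y) ∈ v (l n) t (hl n)})) ∧
    (∀ (u : ℕ → ℝ) (hu : ∀ n, t ≤ u n), Monotone u →
      EvConst (fun n => {x : V t | ∃ y : V (u n), (x, y) ∈ v t (u n) (hu n)}))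

/-- The descending chain condition on kernels (at every `t ∈ ℝ`). -/
def DCConKernels : Prop :=
  ∀ t : ℝ,
    (∀ (u : ℕ → ℝ) (hu : ∀ n, t ≤ u n), Antitone u →
      EvConst (fun n => {x : V t | (x, (0 : V (u n))) ∈ v t (u n) (hu n)})) ∧
    (∀ (l : ℕ → ℝ) (hl : ∀ n, l n ≤ t), Monotone l →
      EvConst (fun n => {y : V t | ((0 : V (l n)), y) ∈ v (l n) t (hl n)}))

/-- A correspondence module is virtually tame if it satisfies the DCC on images and
on kernels at every `t ∈ ℝ`. -/
def VirtuallyTame : Prop := DCConImages V v ∧ DCConKernels V v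

end

/-- For a total preorder `r`, a family of sets that decreases along `r` and is stable along every
`r`-increasing sequence attains its minimum on every nonempty index set. -/
theorem exists_forall_subset_of_evConst {α X : Type*} (r : α → α → Prop) [Std.Refl r]
    [IsTrans α r] (htotal : ∀ a b, r a b ∨ r b a) (F : α → Set X)
    (hF : ∀ a b, r a b → F b ⊆ F a)
    (hstable : ∀ u : ℕ → α, (∀ m n, m ≤ n → r (u m) (u n)) → EvConst fun n => F (u n))
    (J : Set α) (hJ : J.Nonempty) : ∃ a ∈ J, ∀ b ∈ J, F a ⊆ F b := by
  by_contra! hcon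
  choose! next hnext hnot using hcon
  obtain ⟨a, ha⟩ := hJ
  let u : ℕ → α := fun n => next^[n] a
  have hsucc : ∀ n, u (n + 1) = next (u n) := fun n => Function.iterate_succ_apply' next n a
  have hu : ∀ n, u n ∈ J := by
    intro n
    induction n with
    | zero => exact ha
    | succ n ih => rw [hsucc]; exact hnext _ ih
  have hstep : ∀ n, r (u n) (u (n + 1)) := by
    intro n
    rw [hsucc]
    exact (htotal _ _).resolve_right fun h => hnot _ (hu n) (hF _ _ h)
  obtain ⟨N, hN⟩ := hstable u fun m n h => Nat.rel_of_forall_rel_succ_of_le r hstep h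
  have h := hN (N + 1) N.le_succ
  apply hnot _ (hu N)
  rw [← hsucc]
  exact h.symm.subset

section OneSided

variable {k ι : Type*} [Field k] {V : ι → Type*}
  [∀ t, AddCommGroup (V t)] [∀ t, Module k (V t)]
  (r : ι → ι → Prop) [Std.Refl r]
  (v : ∀ s t : ι, r s t → Submodule k (V s × V t))

/-- The domains of the correspondences out of `t` attain their minimum on index sets. -/
theorem exists_minimal_dom [IsTrans ι r] (htotal : ∀ a b, r a b ∨ r b a)
    (hcomp : ∀ (a b c : ι) (hab : r a b) (hbc : r b c) (hac : r a c) (x : V a) (z : V c),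
      (x, z) ∈ v a c hac ↔ ∃ y, (x, y) ∈ v a b hab ∧ (y, z) ∈ v b c hbc)
    (t : ι)
    (hdcc : ∀ (u : ℕ → ι) (hu : ∀ n, r t (u n)), (∀ m n, m ≤ n → r (u m) (u n)) →
      EvConst fun n => {x : V t | ∃ y, (x, y) ∈ v t (u n) (hu n)})
    (J : Set ι) (hJ : ∃ u ∈ J, r t u) :
    ∃ a ∈ J, ∃ ha : r t a, ∀ b ∈ J, ∀ hb : r t b, ∀ x,
      (∃ y, (x, y) ∈ v t a ha) → ∃ y, (x, y) ∈ v t b hb := by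
  let R : {u // r t u} → {u // r t u} → Prop := fun a b => r a b
  have : Std.Refl R := ⟨fun a => Std.Refl.refl a.1⟩
  have : IsTrans _ R := ⟨fun _ _ _ h h' => IsTrans.trans _ _ _ h h'⟩
  obtain ⟨⟨a, hta⟩, ha, hmin⟩ := exists_forall_subset_of_evConst R
    (fun a b => htotal a b) (fun u => {x : V t | ∃ y, (x, y) ∈ v t u.1 u.2})
    (fun a b hab x ⟨y, hy⟩ =>
      let ⟨w, hw, _⟩ := (hcomp t a.1 b.1 a.2 hab b.2 x y).1 hy
      ⟨w, hw⟩)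
    (fun u hu => hdcc (fun n => (u n).1) (fun n => (u n).2) hu)
    {u | u.1 ∈ J} (let ⟨u, hu, htu⟩ := hJ; ⟨⟨u, htu⟩, hu⟩)
  exact ⟨a, ha, hta, fun b hb htb x hx => hmin ⟨b, htb⟩ hb hx⟩

/-- The kernels of the correspondences out of `t` attain their minimum on index sets. -/
theorem exists_minimal_ker [IsTrans ι r] (htotal : ∀ a b, r a b ∨ r b a)
    (hcomp : ∀ (a b c : ι) (hab : r a b) (hbc : r b c) (hac : r a c) (x : V a) (z : V c),
      (x, z) ∈ v a c hac ↔ ∃ y, (x, y) ∈ v a b hab ∧ (y, z) ∈ v b c hbc)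
    (t : ι)
    (hdcc : ∀ (u : ℕ → ι) (hu : ∀ n, r t (u n)), (∀ m n, m ≤ n → r (u n) (u m)) →
      EvConst fun n => {x : V t | (x, (0 : V (u n))) ∈ v t (u n) (hu n)})
    (J : Set ι) (hJ : ∃ u ∈ J, r t u) :
    ∃ a ∈ J, ∃ ha : r t a, ∀ b ∈ J, ∀ hb : r t b, ∀ x,
      (x, (0 : V a)) ∈ v t a ha → (x, (0 : V b)) ∈ v t b hb := by
  let R : {u // r t u} → {u // r t u} → Prop := fun a b => r b a
  have : Std.Refl R := ⟨fun a => Std.Refl.refl a.1⟩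
  have : IsTrans _ R := ⟨fun a b c h h' => IsTrans.trans c.1 b.1 a.1 h' h⟩
  obtain ⟨⟨a, hta⟩, ha, hmin⟩ := exists_forall_subset_of_evConst R
    (fun a b => htotal b a) (fun u => {x : V t | (x, (0 : V u.1)) ∈ v t u.1 u.2})
    (fun a b hab x hx => (hcomp t b.1 a.1 b.2 hab a.2 x 0).2 ⟨0, hx, Submodule.zero_mem _⟩)
    (fun u hu => hdcc (fun n => (u n).1) (fun n => (u n).2) hu)
    {u | u.1 ∈ J} (let ⟨u, hu, htu⟩ := hJ; ⟨⟨u, htu⟩, hu⟩)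
  exact ⟨a, ha, hta, fun b hb htb x hx => hmin ⟨b, htb⟩ hb hx⟩

/-- Let `G` be a compatible family of values whose members have successors and predecessors at all
indices of `I`.  For a value at `t ∈ I`, being compatible with all later members of `G` and having
successors throughout `I` follows from one condition: being related to a given member of `G`, or to
some value at a given index. -/
theorem exists_dominating_condition (htotal : ∀ a b, r a b ∨ r b a)
    (hcomp : ∀ (a b c : ι) (hab : r a b) (hbc : r b c) (hac : r a c) (x : V a) (z : V c),
      (x, z) ∈ v a c hac ↔ ∃ y, (x, y) ∈ v a b hab ∧ (y, z) ∈ v b c hbc)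
    (I : Set ι) (t : ι) (ht : t ∈ I)
    (hdom : ∀ J : Set ι, (∃ u ∈ J, r t u) → ∃ a ∈ J, ∃ ha : r t a, ∀ b ∈ J, ∀ hb : r t b, ∀ x,
      (∃ y, (x, y) ∈ v t a ha) → ∃ y, (x, y) ∈ v t b hb)
    (hker : ∀ J : Set ι, (∃ u ∈ J, r t u) → ∃ a ∈ J, ∃ ha : r t a, ∀ b ∈ J, ∀ hb : r t b, ∀ x,
      (x, (0 : V a)) ∈ v t a ha → (x, (0 : V b)) ∈ v t b hb)
    (G : Set (Σ t, V t)) (hGI : ∀ p ∈ G, p.1 ∈ I)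
    (hG : ∀ p ∈ G, ∀ q ∈ G, ∀ h : r p.1 q.1, (p.2, q.2) ∈ v p.1 q.1 h)
    (hsucc : ∀ p ∈ G, ∀ u ∈ I, ∀ h : r p.1 u, ∃ y, (p.2, y) ∈ v p.1 u h)
    (hpred : ∀ p ∈ G, ∀ l ∈ I, ∀ h : r l p.1, ∃ y, (y, p.2) ∈ v l p.1 h) :
    ∃ a ∈ I, ∃ ha : r t a, ∃ W : Set (V a), (W = Set.univ ∨ ∃ w, ⟨a, w⟩ ∈ G ∧ W = {w}) ∧
      ∀ z, (∃ w ∈ W, (z, w) ∈ v t a ha) →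
        (∀ p ∈ G, ∀ h : r t p.1, (z, p.2) ∈ v t p.1 h) ∧
        ∀ u ∈ I, ∀ h : r t u, ∃ y, (z, y) ∈ v t u h := by
  by_cases hJ : ∃ u ∈ Sigma.fst '' G, r t u
  · obtain ⟨_, ⟨⟨a, w⟩, hw, rfl⟩, ha, hmin⟩ := hker _ hJ
    refine ⟨a, hGI _ hw, ha, {w}, Or.inr ⟨w, hw, rfl⟩, ?_⟩
    rintro z ⟨_, rfl, hz⟩
    refine ⟨fun p hp h => ?_, fun u hu h => ?_⟩
    · rcases htotal a p.1 with hap | hpa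
      · exact (hcomp _ _ _ ha hap h _ _).2 ⟨_, hz, hG _ hw p hp hap⟩
      · obtain ⟨z', hz'⟩ := hpred p hp t ht h
        have hz'a := (hcomp _ _ _ h hpa ha _ _).2 ⟨_, hz', hG p hp _ hw hpa⟩
        have hsub := Submodule.sub_mem _ hz hz'a
        rw [Prod.mk_sub_mk, sub_self] at hsub
        simpa using Submodule.add_mem _ (hmin p.1 ⟨p, hp, rfl⟩ h _ hsub) hz'
    · rcases htotal a u with hau | hua
      · obtain ⟨y, hy⟩ := hsucc _ hw u hu hau
        exact ⟨y, (hcomp _ _ _ ha hau h _ _).2 ⟨_, hz, hy⟩⟩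
      · obtain ⟨y, hy, -⟩ := (hcomp _ _ _ h hua ha _ _).1 hz
        exact ⟨y, hy⟩
  · obtain ⟨a, haI, ha, hmin⟩ := hdom I ⟨t, ht, Std.Refl.refl t⟩
    refine ⟨a, haI, ha, Set.univ, Or.inl rfl, ?_⟩
    rintro z ⟨w, -, hz⟩
    exact ⟨fun p hp h => (hJ ⟨p.1, ⟨p, hp, rfl⟩, h⟩).elim, fun u hu h => hmin u hu h z ⟨w, hz⟩⟩

end OneSided

section

variable {k : Type*} [Field k] (V : ℝ → Type*)
  [∀ t, AddCommGroup (V t)] [∀ t, Module k (V t)]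
  (v : ∀ s t : ℝ, s ≤ t → Submodule k (V s × V t))

/-- A compatible family of values at points of `I`, each of which has successors and predecessors
at all points of `I`. -/
structure IsExtendableFamily (I : Set ℝ) (G : Set (Σ t, V t)) : Prop where
  mem : ∀ p ∈ G, p.1 ∈ I
  compat : ∀ p ∈ G, ∀ q ∈ G, ∀ h : p.1 ≤ q.1, (p.2, q.2) ∈ v p.1 q.1 h
  succ : ∀ p ∈ G, ∀ u ∈ I, ∀ h : p.1 ≤ u, ∃ y, (p.2, y) ∈ v p.1 u h
  pred : ∀ p ∈ G, ∀ l ∈ I, ∀ h : l ≤ p.1, ∃ y, (y, p.2) ∈ v l p.1 h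

variable {V v}

/-- The correspondences of `v`, read backwards. -/
def reverseCorr (v : ∀ s t : ℝ, s ≤ t → Submodule k (V s × V t)) (s t : ℝ) (h : s ≥ t) :
    Submodule k (V s × V t) :=
  (v t s h).comap (LinearEquiv.prodComm k (V s) (V t)).toLinearMap

theorem mem_reverseCorr {s t : ℝ} {h : s ≥ t} {x : V s} {y : V t} :
    (x, y) ∈ reverseCorr v s t h ↔ (y, x) ∈ v t s h := Iff.rfl

theorem reverseCorr_comp
    (hcomp : ∀ (a b c : ℝ) (hab : a ≤ b) (hbc : b ≤ c) (hac : a ≤ c) (x : V a) (z : V c),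
      (x, z) ∈ v a c hac ↔ ∃ y, (x, y) ∈ v a b hab ∧ (y, z) ∈ v b c hbc)
    (a b c : ℝ) (hab : a ≥ b) (hbc : b ≥ c) (hac : a ≥ c) (x : V a) (z : V c) :
    (x, z) ∈ reverseCorr v a c hac ↔
      ∃ y, (x, y) ∈ reverseCorr v a b hab ∧ (y, z) ∈ reverseCorr v b c hbc := by
  simp only [mem_reverseCorr, hcomp c b a hbc hab hac, and_comm]

/-- In a virtually tame module, domains out of `t` attain their minimum on index sets. -/
theorem VirtuallyTame.exists_minimal_dom (htame : VirtuallyTame V v)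
    (hcomp : ∀ (a b c : ℝ) (hab : a ≤ b) (hbc : b ≤ c) (hac : a ≤ c) (x : V a) (z : V c),
      (x, z) ∈ v a c hac ↔ ∃ y, (x, y) ∈ v a b hab ∧ (y, z) ∈ v b c hbc)
    (t : ℝ) (J : Set ℝ) (hJ : ∃ u ∈ J, t ≤ u) :
    ∃ a ∈ J, ∃ ha : t ≤ a, ∀ b ∈ J, ∀ hb : t ≤ b, ∀ x,
      (∃ y, (x, y) ∈ v t a ha) → ∃ y, (x, y) ∈ v t b hb :=
  _root_.exists_minimal_dom (· ≤ ·) v le_total hcomp t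
    (fun u hu hmono => (htame.1 t).2 u hu fun m n h => hmono m n h) J hJ

/-- In a virtually tame module, images at `t` attain their minimum on index sets. -/
theorem VirtuallyTame.exists_minimal_image (htame : VirtuallyTame V v)
    (hcomp : ∀ (a b c : ℝ) (hab : a ≤ b) (hbc : b ≤ c) (hac : a ≤ c) (x : V a) (z : V c),
      (x, z) ∈ v a c hac ↔ ∃ y, (x, y) ∈ v a b hab ∧ (y, z) ∈ v b c hbc)
    (t : ℝ) (J : Set ℝ) (hJ : ∃ l ∈ J, l ≤ t) :
    ∃ a ∈ J, ∃ ha : a ≤ t, ∀ b ∈ J, ∀ hb : b ≤ t, ∀ x,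
      (∃ y, (y, x) ∈ v a t ha) → ∃ y, (y, x) ∈ v b t hb :=
  _root_.exists_minimal_dom (· ≥ ·) (reverseCorr v) (fun a b => le_total b a) (reverseCorr_comp hcomp) t
    (fun l hl hmono => (htame.1 t).1 l hl fun m n h => hmono m n h) J hJ

/-- In a virtually tame module, an extendable family can be enlarged by a value at any given
point of `I`. -/
theorem IsExtendableFamily.exists_insert {I : Set ℝ} {G : Set (Σ t, V t)}
    (hG : IsExtendableFamily V v I G)
    (hid : ∀ t (x : V t), (x, x) ∈ v t t le_rfl)
    (hcomp : ∀ (a b c : ℝ) (hab : a ≤ b) (hbc : b ≤ c) (hac : a ≤ c) (x : V a) (z : V c),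
      (x, z) ∈ v a c hac ↔ ∃ y, (x, y) ∈ v a b hab ∧ (y, z) ∈ v b c hbc)
    (htame : VirtuallyTame V v) {t : ℝ} (ht : t ∈ I) :
    ∃ z : V t, IsExtendableFamily V v I (insert ⟨t, z⟩ G) := by
  obtain ⟨u, huI, htu, W, hW, hright⟩ := exists_dominating_condition (· ≤ ·) v le_total hcomp I t ht
    (htame.exists_minimal_dom hcomp t)
    (exists_minimal_ker (· ≤ ·) v le_total hcomp t
      fun u hu hmono => (htame.2 t).1 u hu fun m n h => hmono m n h)
    G hG.mem hG.compat hG.succ hG.pred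
  obtain ⟨l, hlI, hlt, W', hW', hleft⟩ := exists_dominating_condition (· ≥ ·) (reverseCorr v)
    (fun a b => le_total b a) (reverseCorr_comp hcomp) I t ht
    (htame.exists_minimal_image hcomp t)
    (exists_minimal_ker (· ≥ ·) (reverseCorr v) (fun a b => le_total b a) (reverseCorr_comp hcomp) t
      fun l hl hmono => (htame.2 t).2 l hl fun m n h => hmono m n h)
    G hG.mem (fun p hp q hq h => hG.compat q hq p hp h) hG.pred hG.succ
  have hlu : l ≤ u := le_trans hlt htu
  have hrel : ∃ w' ∈ W', ∃ w ∈ W, (w', w) ∈ v l u hlu := by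
    rcases hW with rfl | ⟨w, hw, rfl⟩ <;> rcases hW' with rfl | ⟨w', hw', rfl⟩
    · exact ⟨0, trivial, 0, trivial, Submodule.zero_mem _⟩
    · obtain ⟨y, hy⟩ := hG.succ _ hw' u huI hlu
      exact ⟨w', rfl, y, trivial, hy⟩
    · obtain ⟨y, hy⟩ := hG.pred _ hw l hlI hlu
      exact ⟨y, trivial, w, rfl, hy⟩
    · exact ⟨w', rfl, w, rfl, hG.compat _ hw' _ hw hlu⟩
  obtain ⟨w', hw', w, hw, hww⟩ := hrel
  obtain ⟨z, hz', hz⟩ := (hcomp l t u hlt htu hlu _ _).1 hww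
  obtain ⟨hzG, hzsucc⟩ := hright z ⟨w, hw, hz⟩
  obtain ⟨hGz, hzpred⟩ := hleft z ⟨w', hw', hz'⟩
  refine ⟨z, ?_, ?_, ?_, ?_⟩
  · rintro p (rfl | hp)
    exacts [ht, hG.mem p hp]
  · rintro p (rfl | hp) q (rfl | hq) h
    exacts [hid t z, hzG q hq h, hGz p hp h, hG.compat p hp q hq h]
  · rintro p (rfl | hp)
    exacts [hzsucc, hG.succ p hp]
  · rintro p (rfl | hp)
    exacts [hzpred, hG.pred p hp]

/-- In a virtually tame module, an extendable family over `I` extends to a section over `I`. -/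
theorem IsExtendableFamily.exists_section {I : Set ℝ} {G : Set (Σ t, V t)}
    (hG : IsExtendableFamily V v I G)
    (hid : ∀ t (x y : V t), (x, y) ∈ v t t le_rfl ↔ y = x)
    (hcomp : ∀ (a b c : ℝ) (hab : a ≤ b) (hbc : b ≤ c) (hac : a ≤ c) (x : V a) (z : V c),
      (x, z) ∈ v a c hac ↔ ∃ y, (x, y) ∈ v a b hab ∧ (y, z) ∈ v b c hbc)
    (htame : VirtuallyTame V v) :
    ∃ g : ∀ t, V t, IsSection V v I g ∧ ∀ p ∈ G, g p.1 = p.2 := by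
  obtain ⟨M, hGM, hM⟩ := zorn_subset_nonempty {G | IsExtendableFamily V v I G}
    (fun c hc hchain _ => ⟨⋃₀ c, by
      refine ⟨?_, ?_, ?_, ?_⟩
      · rintro p ⟨s, hs, hp⟩
        exact (hc hs).mem p hp
      · rintro p ⟨s, hs, hp⟩ q ⟨s', hs', hq⟩
        rcases hchain.total hs hs' with h | h
        · exact (hc hs').compat p (h hp) q hq
        · exact (hc hs).compat p hp q (h hq)
      · rintro p ⟨s, hs, hp⟩
        exact (hc hs).succ p hp
      · rintro p ⟨s, hs, hp⟩
        exact (hc hs).pred p hp, fun _ => Set.subset_sUnion_of_mem⟩) G hG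
  have hMfam : IsExtendableFamily V v I M := hM.prop
  have hfull : ∀ t : ℝ, ∃ z : V t, t ∈ I → ⟨t, z⟩ ∈ M := by
    intro t
    by_cases ht : t ∈ I
    · obtain ⟨z, hz⟩ :=
        hMfam.exists_insert (fun t x => (hid t x x).2 rfl) hcomp htame ht
      exact ⟨z, fun _ => hM.le_of_ge hz (Set.subset_insert _ _) (Set.mem_insert _ _)⟩
    · exact ⟨0, fun h => (ht h).elim⟩
  choose g hg using hfull
  exact ⟨g, fun s hs t ht h => hMfam.compat _ (hg s hs) _ (hg t ht) h, fun p hp =>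
    (hid _ _ _).1 (hMfam.compat _ (hGM hp) _ (hg p.1 (hG.mem p hp)) le_rfl)⟩

end

section

variable {k : Type*} [Field k] (V : ℝ → Type*)
  [∀ t, AddCommGroup (V t)] [∀ t, Module k (V t)]
  (v : ∀ s t : ℝ, s ≤ t → Submodule k (V s × V t))

/-- Let `V` be a virtually tame correspondence module over `(ℝ, ≤)`,
`I₁ ⊆ I₂ ⊆ ⋯` an ascending sequence of intervals, and `A ⊆ ⋂ n, I n` a finite set.  Then for
all sufficiently large `m`, every section over `I m` agrees on `A` with some section over
`⋃ n, I n`. -/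
theorem virtuallyTame_images_restricted_to_finite_set_stabilize
    (hv_id : ∀ t : ℝ, (v t t le_rfl : Set (V t × V t)) = {p | p.2 = p.1})
    (hv_comp : ∀ (r s t : ℝ) (hrs : r ≤ s) (hst : s ≤ t),
      (v r t (hrs.trans hst) : Set (V r × V t)) =
        CorrComp (v r s hrs : Set (V r × V s)) (v s t hst : Set (V s × V t)))
    (htame : VirtuallyTame V v)
    (I : ℕ → Set ℝ) (hImono : Monotone I) (hIint : ∀ n, (I n).OrdConnected)
    (A : Set ℝ) (hA : A ⊆ ⋂ n, I n) (hAfin : A.Finite) :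
    ∃ m₀ : ℕ, ∀ m ≥ m₀, ∀ s : ∀ t : ℝ, V t, IsSection V v (I m) s →
      ∃ g : ∀ t : ℝ, V t, IsSection V v (⋃ n, I n) g ∧ ∀ t ∈ A, g t = s t := by
  have hid : ∀ t (x y : V t), (x, y) ∈ v t t le_rfl ↔ y = x :=
    fun t x y => Set.ext_iff.1 (hv_id t) (x, y)
  have hcomp : ∀ (a b c : ℝ) (hab : a ≤ b) (hbc : b ≤ c) (hac : a ≤ c) (x : V a) (z : V c),
      (x, z) ∈ v a c hac ↔ ∃ y, (x, y) ∈ v a b hab ∧ (y, z) ∈ v b c hbc :=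
    fun a b c hab hbc _ x z => Set.ext_iff.1 (hv_comp a b c hab hbc) (x, z)
  have hAI : ∀ t ∈ A, ∀ n, t ∈ I n := fun t ht => Set.mem_iInter.1 (hA ht)
  have hpoint : ∀ t ∈ A, ∃ N, ∀ m ≥ N, ∀ s : ∀ t : ℝ, V t, IsSection V v (I m) s →
      (∀ u ∈ ⋃ n, I n, ∀ h : t ≤ u, ∃ y, (s t, y) ∈ v t u h) ∧
      ∀ l ∈ ⋃ n, I n, ∀ h : l ≤ t, ∃ y, (y, s t) ∈ v l t h := by
    intro t ht
    have htI : t ∈ ⋃ n, I n := Set.mem_iUnion.2 ⟨0, hAI t ht 0⟩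
    obtain ⟨a, haI, ha, hdom⟩ := htame.exists_minimal_dom hcomp t _ ⟨t, htI, le_rfl⟩
    obtain ⟨b, hbI, hb, him⟩ := htame.exists_minimal_image hcomp t _ ⟨t, htI, le_rfl⟩
    obtain ⟨i, hi⟩ := Set.mem_iUnion.1 haI
    obtain ⟨j, hj⟩ := Set.mem_iUnion.1 hbI
    refine ⟨max i j, fun m hm s hs => ⟨fun u hu h => hdom u hu h _ ⟨s a, ?_⟩,
      fun l hl h => him l hl h _ ⟨s b, ?_⟩⟩⟩
    · exact hs t (hAI t ht m) a (hImono ((le_max_left i j).trans hm) hi) ha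
    · exact hs b (hImono ((le_max_right i j).trans hm) hj) t (hAI t ht m) hb
  choose! N hN using hpoint
  obtain ⟨m₀, hm₀⟩ := (hAfin.image N).bddAbove
  refine ⟨m₀, fun m hm s hs => ?_⟩
  have hNm : ∀ t ∈ A, m ≥ N t := fun t ht => (hm₀ ⟨t, ht, rfl⟩).trans hm
  have hG : IsExtendableFamily V v (⋃ n, I n) ((fun t => ⟨t, s t⟩) '' A) := by
    refine ⟨?_, ?_, ?_, ?_⟩
    · rintro _ ⟨t, ht, rfl⟩
      exact Set.mem_iUnion.2 ⟨0, hAI t ht 0⟩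
    · rintro _ ⟨t, ht, rfl⟩ _ ⟨t', ht', rfl⟩ h
      exact hs t (hAI t ht m) t' (hAI t' ht' m) h
    · rintro _ ⟨t, ht, rfl⟩
      exact (hN t ht m (hNm t ht) s hs).1
    · rintro _ ⟨t, ht, rfl⟩
      exact (hN t ht m (hNm t ht) s hs).2
  obtain ⟨g, hg, hgs⟩ := hG.exists_section hid hcomp htame
  exact ⟨g, hg, fun t ht => hgs _ ⟨t, ht, rfl⟩⟩

end
end

section
/- Let k be a field and V a k-vector space. Suppose {(F_λ⁻, F_λ⁺) : λ ∈ Λ} is a family of splittings of V that is disjoint and covers V, and {(G_σ⁻, G_σ⁺) : σ ∈ Σ} is a family of splittings of V that is disjoint and strongly covers V. If for each (σ, λ) ∈ Σ × Λ the subspace W_{σ,λ} is a complement of (F_λ⁻ ∩ G_σ⁺) + (G_σ⁻ ∩ F_λ⁺) in G_σ⁺ ∩ F_λ⁺, then for every λ ∈ Λ the subspace F_λ⁺ is the internal direct sum of F_λ⁻ together with the family {W_{σ,λ} : σ ∈ Σ}: the subspaces F_λ⁻ and W_{σ,λ} (σ ∈ Σ) are independent and their sum is F_λ⁺. -/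
section

variable {k V : Type*} [Field k] [AddCommGroup V] [Module k V] {Λ : Type*}

/-- A family of splittings `(Fm λ, Fp λ)` (with `Fm λ ⊆ Fp λ`) is disjoint if for all
`λ ≠ μ` either `Fp λ ⊆ Fm μ` or `Fp μ ⊆ Fm λ`. -/
def DisjointSplittings (Fm Fp : Λ → Submodule k V) : Prop :=
  ∀ l m : Λ, l ≠ m → Fp l ≤ Fm m ∨ Fp m ≤ Fm l

/-- A family of splittings covers `V` if for every proper subspace `U ⊊ V` there is `λ`
with `U + Fm λ ≠ U + Fp λ`. -/
def CoversSplittings (Fm Fp : Λ → Submodule k V) : Prop :=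
  ∀ U : Submodule k V, U ≠ ⊤ → ∃ l : Λ, U ⊔ Fm l ≠ U ⊔ Fp l

/-- A family of splittings strongly covers `V` if for all subspaces `U, W` with `W ⊄ U`
there is `λ` with `U + (Fm λ ∩ W) ≠ U + (Fp λ ∩ W)`. -/
def StronglyCoversSplittings (Fm Fp : Λ → Submodule k V) : Prop :=
  ∀ U W : Submodule k V, ¬ W ≤ U → ∃ l : Λ, U ⊔ (Fm l ⊓ W) ≠ U ⊔ (Fp l ⊓ W)

theorem DisjointSplittings.exists_forall_le {Gm Gp : Λ → Submodule k V}
    (hsplit : ∀ s, Gm s ≤ Gp s) (hdisj : DisjointSplittings Gm Gp)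
    {T : Finset Λ} (hT : T.Nonempty) : ∃ s ∈ T, ∀ t ∈ T, t ≠ s → Gp t ≤ Gm s := by
  classical
  induction hT using Finset.Nonempty.cons_induction with
  | singleton a => exact ⟨a, by simp, fun t ht hne => absurd (by simpa using ht) hne⟩
  | cons a T ha _ ih =>
    obtain ⟨s, hs, hmax⟩ := ih
    have has : a ≠ s := fun h => ha (h ▸ hs)
    rcases hdisj a s has with h | h
    · refine ⟨s, by simp [hs], fun t ht hne => ?_⟩
      rcases Finset.mem_cons.1 ht with rfl | ht
      · exact h
      · exact hmax t ht hne
    · refine ⟨a, by simp, fun t ht hne => ?_⟩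
      rcases Finset.mem_cons.1 ht with rfl | ht
      · exact absurd rfl hne
      · by_cases hts : t = s
        · exact hts ▸ h
        · exact ((hmax t ht hts).trans (hsplit s)).trans h

theorem DisjointSplittings.eq_zero_of_sum_mem {Gm Gp W : Λ → Submodule k V}
    (hsplit : ∀ s, Gm s ≤ Gp s) (hdisj : DisjointSplittings Gm Gp) {A B : Submodule k V}
    (hW : ∀ s, W s ≤ Gp s ⊓ B) (hAW : ∀ s, ((A ⊓ Gp s) ⊔ (Gm s ⊓ B)) ⊓ W s = ⊥)
    (w : Λ → V) (T : Finset Λ) (hw : ∀ t ∈ T, w t ∈ W t) (hsum : ∑ t ∈ T, w t ∈ A) :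
    ∀ t ∈ T, w t = 0 := by
  classical
  induction T using Finset.strongInduction with
  | H T ih =>
    rcases T.eq_empty_or_nonempty with rfl | hT
    · simp
    obtain ⟨s, hs, hmax⟩ := hdisj.exists_forall_le hsplit hT
    have hrest : ∑ t ∈ T.erase s, w t ∈ Gm s ⊓ B := by
      refine Submodule.sum_mem _ fun t ht => ?_
      obtain ⟨hne, ht⟩ := Finset.mem_erase.1 ht
      have := hW t (hw t ht)
      exact ⟨hmax t ht hne this.1, this.2⟩
    have hdecomp := Finset.add_sum_erase T w hs
    have htotal : ∑ t ∈ T, w t ∈ A ⊓ Gp s :=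
      ⟨hsum, hdecomp ▸ add_mem (hW s (hw s hs)).1 (hsplit s hrest.1)⟩
    have hws : w s = 0 := by
      rw [← Submodule.mem_bot k, ← hAW s]
      refine ⟨?_, hw s hs⟩
      rw [eq_sub_of_add_eq hdecomp]
      exact sub_mem (Submodule.mem_sup_left htotal) (Submodule.mem_sup_right hrest)
    rw [hws, zero_add] at hdecomp
    have herase := ih (T.erase s) (Finset.erase_ssubset hs)
      (fun t ht => hw t (Finset.mem_of_mem_erase ht)) (hdecomp ▸ hsum)
    intro t ht
    by_cases hts : t = s
    · exact hts ▸ hws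
    · exact herase t (Finset.mem_erase.2 ⟨hts, ht⟩)

/-- Crawley-Boevey / Corollary 5.3(ii): Under the hypotheses of Statement 13,
for every `λ` the subspace `Fp λ` is the internal direct sum of `Fm λ` together with the
family `{W (σ, λ) : σ}`: the family consisting of `Fm λ` and the `W (σ, λ)` is independent
and its sum is `Fp λ`. -/
theorem refined_splittings_direct_sum_of_Fp
    {Sig : Type*}
    (Fm Fp : Λ → Submodule k V)
    (hFsplit : ∀ l : Λ, Fm l ≤ Fp l)
    (hFdisj : DisjointSplittings Fm Fp)
    (hFcov : CoversSplittings Fm Fp)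
    (Gm Gp : Sig → Submodule k V)
    (hGsplit : ∀ s : Sig, Gm s ≤ Gp s)
    (hGdisj : DisjointSplittings Gm Gp)
    (hGcov : StronglyCoversSplittings Gm Gp)
    (W : Sig × Λ → Submodule k V)
    (hWdisj : ∀ s : Sig, ∀ l : Λ,
      ((Fm l ⊓ Gp s) ⊔ (Gm s ⊓ Fp l)) ⊓ W (s, l) = ⊥)
    (hWsum : ∀ s : Sig, ∀ l : Λ,
      ((Fm l ⊓ Gp s) ⊔ (Gm s ⊓ Fp l)) ⊔ W (s, l) = Gp s ⊓ Fp l) :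
    ∀ l : Λ,
      iSupIndep (fun o : Option Sig => o.elim (Fm l) (fun s => W (s, l))) ∧
      (⨆ o : Option Sig, o.elim (Fm l) (fun s => W (s, l))) = Fp l := by
  classical
  intro l
  have hW (s : Sig) : W (s, l) ≤ Gp s ⊓ Fp l := hWsum s l ▸ le_sup_right
  constructor
  · rw [iSupIndep_iff_finsetSum_eq_zero_imp_eq_zero]
    intro S v hv hsum
    have hnone : (if none ∈ S then v none else 0) ∈ Fm l := by
      split_ifs with h
      · exact hv none h
      · exact zero_mem _
    have hsplitSum : (if none ∈ S then v none else 0) + ∑ t ∈ S.eraseNone, v (some t) = 0 := by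
      have hmap : ∑ t ∈ S.eraseNone, v (some t) = ∑ o ∈ S.erase none, v o := by
        rw [← Finset.map_some_eraseNone, Finset.sum_map]
        rfl
      rw [hmap]
      split_ifs with h
      · exact (Finset.add_sum_erase S v h).trans hsum
      · rw [Finset.erase_eq_of_notMem h, zero_add, hsum]
    have hsome : ∀ t ∈ S.eraseNone, v (some t) = 0 :=
      hGdisj.eq_zero_of_sum_mem (W := fun s => W (s, l)) hGsplit hW (fun s => hWdisj s l) _ _
        (fun t ht => hv (some t) (Finset.mem_eraseNone.1 ht))
        (eq_neg_of_add_eq_zero_right hsplitSum ▸ neg_mem hnone)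
    rintro (_ | t) ho
    · rwa [Finset.sum_eq_zero hsome, add_zero, if_pos ho] at hsplitSum
    · exact hsome t (Finset.mem_eraseNone.2 ho)
  · rw [iSup_option]
    refine le_antisymm (sup_le (hFsplit l) (iSup_le fun s => (hW s).trans inf_le_right)) ?_
    by_contra hlt
    obtain ⟨s, hs⟩ := hGcov _ _ hlt
    refine hs (le_antisymm (sup_le_sup_left (inf_le_inf_right _ (hGsplit s)) _) ?_)
    refine sup_le le_sup_left ?_
    rw [← hWsum s l]
    refine sup_le (sup_le ?_ le_sup_right) ?_
    · exact inf_le_left.trans (le_sup_left.trans le_sup_left)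
    · exact (le_iSup (fun s => W (s, l)) s).trans (le_sup_right.trans le_sup_left)

end
end
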